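/- arXiv:2212.14469 — 9 statements merged into one kernel-verified Lean document; each statement's English description precedes it below -/
import Mathlib

section
/- Let φ : B → A be an injective local homomorphism of commutative noetherian local rings making A a finitely generated B-module. If A is complete with respect to its maximal ideal (i.e., A is m_A-adically complete), then B is complete with respect to its maximal ideal. -/
open IsLocalRing

/-- Krull's intersection theorem: submodules of a finite module over a noetherian local ring
are closed in the adic topology of the maximal ideal. -/
lemma Submodule.mem_of_forall_exists_sub_mem_maximalIdeal_pow_smul
    {R M : Type*} [CommRing R] [IsLocalRing R] [IsNoetherianRing R] [AddCommGroup M] [Module R M]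
    [Module.Finite R M] (N : Submodule R M) (x : M)
    (h : ∀ n : ℕ, ∃ y ∈ N, x - y ∈ (maximalIdeal R ^ n • ⊤ : Submodule R M)) : x ∈ N := by
  rw [← Submodule.Quotient.mk_eq_zero]
  refine IsHausdorff.haus (I := maximalIdeal R) inferInstance _ fun n ↦ ?_
  obtain ⟨y, hy, hxy⟩ := h n
  rw [SModEq.zero]
  have hmap := Submodule.mem_map_of_mem (f := N.mkQ) hxy
  rw [Submodule.map_smul'', Submodule.map_top, Submodule.range_mkQ, map_sub,
    Submodule.mkQ_apply, Submodule.mkQ_apply, (Submodule.Quotient.mk_eq_zero N).2 hy,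
    sub_zero] at hmap
  exact hmap

/-- The Artin-Rees lemma for an injective linear map: the topology of the source is induced
from that of the target. -/
lemma Ideal.exists_forall_mem_pow_smul_top_of_injective
    {R M N : Type*} [CommRing R] [IsNoetherianRing R] [AddCommGroup M] [Module R M]
    [AddCommGroup N] [Module R N] [Module.Finite R N] (I : Ideal R) (f : M →ₗ[R] N)
    (hf : Function.Injective f) :
    ∃ k : ℕ, ∀ (n : ℕ) (x : M), f x ∈ (I ^ (n + k) • ⊤ : Submodule R N) →
      x ∈ (I ^ n • ⊤ : Submodule R M) := by
  obtain ⟨k, hk⟩ := I.exists_pow_inf_eq_pow_smul (LinearMap.range f)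
  refine ⟨k, fun n x hx ↦ ?_⟩
  have hmem : f x ∈ (I ^ (n + k) • ⊤ ⊓ LinearMap.range f : Submodule R N) :=
    ⟨hx, LinearMap.mem_range_self f x⟩
  rw [hk (n + k) (Nat.le_add_left k n), Nat.add_sub_cancel] at hmem
  have hmap : f x ∈ (I ^ n • ⊤ : Submodule R M).map f := by
    rw [Submodule.map_smul'', Submodule.map_top]
    exact Submodule.smul_mono le_rfl inf_le_right hmem
  exact (hf.mem_set_image).1 hmap

/-- If `φ : B → A` (here realized as `algebraMap B A`) is an injective
local homomorphism of commutative noetherian local rings making `A` a finitely generated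
`B`-module, and `A` is complete with respect to its maximal ideal, then `B` is complete
with respect to its maximal ideal. -/
theorem complete_of_module_finite_local_extension
    (B A : Type*) [CommRing B] [CommRing A] [IsLocalRing B] [IsLocalRing A]
    [IsNoetherianRing B] [IsNoetherianRing A] [Algebra B A]
    (hinj : Function.Injective (algebraMap B A))
    (hloc : IsLocalHom (algebraMap B A))
    [Module.Finite B A]
    (hA : IsAdicComplete (maximalIdeal A) A) :
    IsAdicComplete (maximalIdeal B) B := by
  suffices IsPrecomplete (maximalIdeal B) B from { }
  refine ⟨fun f hf ↦ ?_⟩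
  have hle : (maximalIdeal B).map (algebraMap B A) ≤ maximalIdeal A :=
    ((local_hom_TFAE (algebraMap B A)).out 0 2).1 hloc
  have hcauchy {m n : ℕ} (hmn : m ≤ n) :
      algebraMap B A (f m) - algebraMap B A (f n) ∈
        (maximalIdeal B ^ m).map (algebraMap B A) := by
    rw [← map_sub]
    refine Ideal.mem_map_of_mem _ ?_
    simpa [SModEq.sub_mem] using hf hmn
  obtain ⟨a, ha⟩ := hA.prec' (fun n ↦ algebraMap B A (f n)) fun {m n} hmn ↦ by
    rw [SModEq.sub_mem, smul_eq_mul, Ideal.mul_top]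
    refine Ideal.pow_right_mono hle m ?_
    rw [← Ideal.map_pow]
    exact hcauchy hmn
  have hlim (n : ℕ) : algebraMap B A (f n) - a ∈
      (maximalIdeal B ^ n • ⊤ : Submodule B A) := by
    rw [Ideal.smul_top_eq_map, Submodule.restrictScalars_mem]
    refine Submodule.mem_of_forall_exists_sub_mem_maximalIdeal_pow_smul _ _ fun m ↦
      ⟨_, hcauchy (Nat.le_add_right n m), ?_⟩
    rw [sub_sub_sub_cancel_left]
    exact Submodule.smul_mono_left (Ideal.pow_le_pow_right (Nat.le_add_left m n))
      (SModEq.sub_mem.1 (ha (n + m)))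
  obtain ⟨b, rfl⟩ : a ∈ LinearMap.range (Algebra.linearMap B A) :=
    Submodule.mem_of_forall_exists_sub_mem_maximalIdeal_pow_smul _ _ fun n ↦
      ⟨_, ⟨f n, rfl⟩, by simpa using neg_mem (hlim n)⟩
  obtain ⟨k, hk⟩ := (maximalIdeal B).exists_forall_mem_pow_smul_top_of_injective
    (Algebra.linearMap B A) hinj
  refine ⟨b, fun n ↦ (hf (Nat.le_add_right n k)).trans (SModEq.sub_mem.2 (hk n _ ?_))⟩
  rw [map_sub]
  exact hlim (n + k)
end

section
/- Let φ : B → A be an injective local homomorphism of commutative noetherian local rings making A a finitely generated B-module. If A is a henselian local ring, then B is a henselian local ring. -/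
open Polynomial IsLocalRing in
/-- Let `A` be a local ring, integral over a local ring `B` along a local homomorphism. If `a : A`
is a root of a polynomial over `B` and lifts a simple root of its reduction lying in the residue
field of `B`, then `a` comes from `B`. -/
theorem IsLocalRing.mem_range_algebraMap_of_isRoot_of_sub_mem
    {B A : Type*} [CommRing B] [CommRing A] [IsLocalRing B] [IsLocalRing A] [Algebra B A]
    [IsLocalHom (algebraMap B A)] [Algebra.IsIntegral B A] {a : A} {f : B[X]} {a₀ : B}
    (h₀ : f.eval a₀ ∈ maximalIdeal B) (h₁ : IsUnit (f.derivative.eval a₀))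
    (ha : aeval a f = 0) (haa₀ : a - algebraMap B A a₀ ∈ maximalIdeal A) :
    ∃ b : B, algebraMap B A b = a := by
  obtain ⟨h, hh⟩ := X_sub_C_dvd_sub_C_eval (a := a₀) (p := f)
  have hder : f.derivative.eval a₀ = h.eval a₀ := by
    simpa using congrArg (fun p ↦ p.derivative.eval a₀) hh
  have hunit : IsUnit (aeval a h) := by
    have hd : aeval a h - algebraMap B A (h.eval a₀) ∈ maximalIdeal A := by
      have := sub_dvd_eval_sub a (algebraMap B A a₀) (h.map (algebraMap B A))
      rw [eval_map_algebraMap, eval_map_apply] at this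
      exact Ideal.mem_of_dvd _ this haa₀
    by_contra hn
    have hmem := (Submodule.sub_mem_iff_right _ ((mem_maximalIdeal _).mpr hn)).mp hd
    exact (mem_maximalIdeal _).mp hmem ((hder ▸ h₁).map (algebraMap B A))
  let S := Algebra.adjoin B {a}
  have haeval (p : B[X]) : aeval a p ∈ S := aeval_mem_adjoin_singleton B a
  have : Algebra.IsIntegral S A := .tower_top B
  obtain ⟨u, hu⟩ : ∃ u ∈ S, aeval a h * u = 1 := by
    obtain ⟨u, hu⟩ := (isUnit_of_map_unit (algebraMap S A) ⟨_, haeval h⟩ hunit).exists_right_inv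
    exact ⟨u, u.2, congrArg Subtype.val hu⟩
  have key : S.toSubmodule ≤ (⊥ : Subalgebra B A).toSubmodule := by
    refine Submodule.le_of_le_smul_of_le_jacobson_bot (I := maximalIdeal B)
      (Algebra.IsIntegral.isIntegral a).fg_adjoin_singleton (jacobson_eq_maximalIdeal ⊥ bot_ne_top).ge ?_
    intro x hx
    obtain ⟨p, rfl⟩ := Algebra.adjoin_mem_exists_aeval B a hx
    obtain ⟨q, hq⟩ := X_sub_C_dvd_sub_C_eval (a := a₀) (p := p)
    have hp := congrArg (aeval a) hq
    have hf := congrArg (aeval a) hh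
    simp only [map_sub, map_mul, aeval_X, aeval_C, ha] at hp hf
    have hx' : aeval a p = algebraMap B A (p.eval a₀) + f.eval a₀ • (-(u * aeval a q)) := by
      rw [Algebra.smul_def]
      linear_combination hp - (u * aeval a q) * hf - (a - algebraMap B A a₀) * aeval a q * hu.2
    rw [hx']
    exact Submodule.add_mem_sup (Subalgebra.algebraMap_mem _ _)
      (Submodule.smul_mem_smul h₀ (S.neg_mem (S.mul_mem hu.1 (haeval q))))
  exact Algebra.mem_bot.mp (key (Algebra.self_mem_adjoin_singleton B a))

/-- If `φ : B → A` (here realized as `algebraMap B A`) is an injective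
local homomorphism of commutative noetherian local rings making `A` a finitely generated
`B`-module, and `A` is a henselian local ring, then `B` is a henselian local ring. -/
theorem henselian_of_module_finite_local_extension
    (B A : Type*) [CommRing B] [CommRing A] [IsLocalRing B] [IsLocalRing A]
    [IsNoetherianRing B] [IsNoetherianRing A] [Algebra B A]
    (hinj : Function.Injective (algebraMap B A))
    (hloc : IsLocalHom (algebraMap B A))
    [Module.Finite B A]
    (hA : HenselianLocalRing A) :
    HenselianLocalRing B := by
  refine ⟨fun f hf a₀ h₀ h₁ ↦ ?_⟩
  obtain ⟨a, ha, haa₀⟩ := hA.is_henselian (f.map (algebraMap B A)) (hf.map _)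
    (algebraMap B A a₀)
    (by
      rw [Polynomial.eval_map_apply]
      exact (IsLocalRing.mem_maximalIdeal _).mpr (map_mem_nonunits_iff _ _ |>.mpr h₀))
    (by
      rw [Polynomial.derivative_map, Polynomial.eval_map_apply]
      exact h₁.map _)
  rw [Polynomial.IsRoot, Polynomial.eval_map_algebraMap] at ha
  obtain ⟨b, rfl⟩ := IsLocalRing.mem_range_algebraMap_of_isRoot_of_sub_mem h₀ h₁ ha haa₀
  refine ⟨b, hinj (by rwa [map_zero, ← Polynomial.aeval_algebraMap_apply_eq_algebraMap_eval]), ?_⟩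
  rw [← map_sub] at haa₀
  exact (IsLocalRing.mem_maximalIdeal _).mpr fun h ↦
    (IsLocalRing.mem_maximalIdeal _).mp haa₀ (h.map _)
end

section
/- Let G be a finite group acting by ring automorphisms on a commutative noetherian local ring A such that A is finitely generated as a module over the fixed subring A^G. If A is henselian, then A^G is a henselian local ring. -/
/-- The subring of elements of `A` fixed by every element of `G`. -/
def fixedSubring (G A : Type*) [Group G] [CommRing A] [MulSemiringAction G A] :
    Subring A where
  carrier := {a : A | ∀ g : G, g • a = a}
  zero_mem' := fun g => smul_zero g
  one_mem' := fun g => smul_one g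
  add_mem' := fun {a b} ha hb g => by rw [smul_add, ha g, hb g]
  mul_mem' := fun {a b} ha hb g => by rw [smul_mul', ha g, hb g]
  neg_mem' := fun {a} ha g => by rw [smul_neg, ha g]

theorem isLocalHom_fixedSubring_subtype (G A : Type*) [Group G] [CommRing A]
    [MulSemiringAction G A] : IsLocalHom (fixedSubring G A).subtype where
  map_nonunit a ha := by
    obtain ⟨b, hb⟩ := isUnit_iff_exists_inv.mp ha
    have hab : (a : A) * b = 1 := hb
    refine isUnit_iff_exists_inv.mpr ⟨⟨b, fun g => ?_⟩, Subtype.ext hab⟩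
    refine ha.mul_left_cancel ?_
    have h : g • ((a : A) * b) = g • (1 : A) := congrArg (g • ·) hab
    rw [smul_mul', smul_one, a.2 g] at h
    exact h.trans hab.symm

theorem smul_eval_map_fixedSubring_subtype {G A : Type*} [Group G] [CommRing A]
    [MulSemiringAction G A] (f : Polynomial (fixedSubring G A)) (g : G) (a : A) :
    g • (f.map (fixedSubring G A).subtype).eval a =
      (f.map (fixedSubring G A).subtype).eval (g • a) := by
  have h : (MulSemiringAction.toRingHom G A g).comp (fixedSubring G A).subtype =
      (fixedSubring G A).subtype := RingHom.ext fun x => x.2 g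
  have h' := Polynomial.hom_eval₂ f (fixedSubring G A).subtype
    (MulSemiringAction.toRingHom G A g) a
  rw [h] at h'
  simpa [Polynomial.eval_map] using h'

/-- Let a finite group `G` act by ring automorphisms on a commutative
noetherian local ring `A` such that `A` is module finite over the fixed subring `A^G`.
If `A` is henselian, then `A^G` is a henselian local ring. -/
theorem fixedSubring_henselian (G A : Type*) [Group G] [Finite G] [CommRing A]
    [IsLocalRing A] [IsNoetherianRing A] [MulSemiringAction G A]
    [Module.Finite (fixedSubring G A) A]
    (hA : HenselianLocalRing A) :
    HenselianLocalRing (fixedSubring G A) := by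
  have hloc := isLocalHom_fixedSubring_subtype G A
  have := RingHom.domain_isLocalRing (fixedSubring G A).subtype
  refine { is_henselian := fun f hf a₀ h₀ h₁ => ?_ }
  have hd : ((f.map (fixedSubring G A).subtype).derivative.eval (a₀ : A)) =
      (fixedSubring G A).subtype (f.derivative.eval a₀) := by
    rw [Polynomial.derivative_map]
    exact Polynomial.eval_map_apply (fixedSubring G A).subtype a₀
  have hv : (f.map (fixedSubring G A).subtype).eval (a₀ : A) =
      (fixedSubring G A).subtype (f.eval a₀) :=
    Polynomial.eval_map_apply (fixedSubring G A).subtype a₀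
  obtain ⟨a, ha, haa⟩ := HenselianLocalRing.is_henselian _
    (hf.map (fixedSubring G A).subtype) (a₀ : A)
    (by rw [hv]; exact fun h => h₀ (hloc.map_nonunit _ h)) (by rw [hd]; exact h₁.map _)
  have hda : IsUnit ((f.map (fixedSubring G A).subtype).derivative.eval a) := by
    by_contra h
    have h2 := Ideal.mem_of_dvd _ (Polynomial.sub_dvd_eval_sub a (a₀ : A)
      (f.map (fixedSubring G A).subtype).derivative) haa
    have h3 := (Submodule.sub_mem_iff_right _ h).mp h2
    rw [hd] at h3
    exact h3 (h₁.map _)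
  have hfix (g : G) : g • a = a := by
    have hg : g • (a - a₀) ∈ IsLocalRing.maximalIdeal A := fun h => haa <| by
      simpa using h.map (MulSemiringAction.toRingHom G A g⁻¹)
    rw [smul_sub, a₀.2 g] at hg
    refine (IsLocalRing.eq_of_eval_eq_zero_of_not_isUnit_sub ha ?_ ?_ hda).symm
    · rw [← smul_eval_map_fixedSubring_subtype, ha.eq_zero, smul_zero]
    · simpa using Ideal.sub_mem _ haa hg
  refine ⟨⟨a, hfix⟩, Subtype.ext ?_, fun h => haa (h.map (fixedSubring G A).subtype)⟩
  exact (Polynomial.eval_map_apply (fixedSubring G A).subtype ⟨a, hfix⟩).symm.trans ha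
end

section
/- Let G be a finite group acting by ring automorphisms on a commutative noetherian local ring A such that A is finitely generated as a module over the fixed subring A^G. If A is complete with respect to its maximal ideal, then A^G is a local ring that is complete with respect to its maximal ideal. -/
open IsLocalRing

/-- A finite module `M` is Noetherian as soon as all its quotients `M ⧸ b M` with `b M ≠ 0` are. -/
theorem isNoetherian_of_forall_isNoetherian_quotient_smul {B M : Type*} [CommRing B]
    [AddCommGroup M] [Module B M] [Module.Finite B M]
    (h : ∀ b : B, LinearMap.range (LinearMap.lsmul B M b) ≠ ⊥ →
      IsNoetherian B (M ⧸ LinearMap.range (LinearMap.lsmul B M b))) :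
    IsNoetherian B M := by
  obtain ⟨s, hs⟩ := Module.Finite.fg_top (R := B) (M := M)
  have range_le : ∀ (b : B) (N : Submodule B M),
      LinearMap.range (LinearMap.lsmul B M b) ≤ N ↔ ∀ m ∈ s, b • m ∈ N := by
    intro b N
    rw [LinearMap.range_eq_map, ← hs, Submodule.map_span_le]
    simp
  -- Choose `N` maximal among the submodules such that `M ⧸ N` has the same annihilator as `M`.
  obtain ⟨N, -, hN⟩ := zorn_le_nonempty₀
    {N : Submodule B M | ∀ b : B, LinearMap.range (LinearMap.lsmul B M b) ≤ N →
      LinearMap.range (LinearMap.lsmul B M b) = ⊥}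
    (by
      intro c hc hchain y hy
      refine ⟨sSup c, fun b hb => ?_, fun z hz => le_sSup hz⟩
      have hfg : (LinearMap.range (LinearMap.lsmul B M b)).FG := by
        rw [LinearMap.range_eq_map]
        exact Module.Finite.fg_top.map _
      obtain ⟨N, hNc, hN⟩ := (CompleteLattice.isCompactElement_iff_le_of_directed_sSup_le _ _).1
        ((Submodule.fg_iff_compact _).1 hfg) c ⟨y, hy⟩ hchain.directedOn hb
      exact hc hNc b hN)
    ⊥ (fun b hb => le_bot_iff.1 hb)
  have hMN : IsNoetherian B (M ⧸ N) := by
    refine ⟨fun K => ?_⟩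
    have hNK : N ≤ K.comap N.mkQ := by
      simpa using LinearMap.ker_le_comap (p := K) N.mkQ
    rw [← Submodule.map_comap_eq_of_surjective (f := N.mkQ) N.mkQ_surjective K]
    by_cases hK : K.comap N.mkQ ≤ N
    · rw [LinearMap.le_ker_iff_map.1 (hK.trans_eq N.ker_mkQ.symm)]
      exact Submodule.fg_bot
    · have hK' : K.comap N.mkQ ∉ {N : Submodule B M | ∀ b : B,
          LinearMap.range (LinearMap.lsmul B M b) ≤ N →
          LinearMap.range (LinearMap.lsmul B M b) = ⊥} := fun hmem => hK (hN.2 hmem hNK)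
      simp only [Set.mem_ofPred_eq, not_forall] at hK'
      obtain ⟨b, hbK, hb⟩ := hK'
      have := h b hb
      refine Submodule.FG.map _ (Submodule.fg_of_fg_map_of_fg_inf_ker
        (LinearMap.range (LinearMap.lsmul B M b)).mkQ (IsNoetherian.noetherian _) ?_)
      rw [Submodule.ker_mkQ, inf_eq_right.2 hbK, LinearMap.range_eq_map]
      exact Module.Finite.fg_top.map _
  let f : B →ₗ[B] (s → M ⧸ N) :=
    LinearMap.pi fun m => N.mkQ ∘ₗ LinearMap.toSpanSingleton B M m
  have hf : ∀ b ∈ LinearMap.ker f, ∀ m : M, b • m = 0 := by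
    intro b hb m
    have hbN : LinearMap.range (LinearMap.lsmul B M b) ≤ N := by
      rw [range_le]
      intro m hm
      have := congrFun (LinearMap.mem_ker.1 hb) ⟨m, hm⟩
      simpa [f, ← Submodule.Quotient.mk_smul, Submodule.Quotient.mk_eq_zero] using this
    have : LinearMap.lsmul B M b m ∈ LinearMap.range (LinearMap.lsmul B M b) := ⟨m, rfl⟩
    rw [hN.1 b hbN] at this
    simpa using this
  have hBf : IsNoetherian B (B ⧸ LinearMap.ker f) :=
    isNoetherian_of_injective ((LinearMap.ker f).liftQ f le_rfl)
      (LinearMap.ker_eq_bot.1 (Submodule.ker_liftQ_eq_bot _ _ _ le_rfl))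
  have hspan : ∀ m : s, IsNoetherian B (Submodule.span B {(m : M)}) := by
    intro m
    rw [← LinearMap.range_toSpanSingleton,
      ← Submodule.range_liftQ (LinearMap.ker f) (LinearMap.toSpanSingleton B M m)
        (fun b hb => by simpa using hf b hb m)]
    infer_instance
  have htop : (⨆ m : s, Submodule.span B {(m : M)}) = ⊤ := by
    rw [← hs, ← Submodule.span_iUnion]
    congr 1
    ext; simp
  have : IsNoetherian B (⨆ m : s, Submodule.span B {(m : M)} : Submodule B M) :=
    isNoetherian_iSup
  rw [htop] at this
  exact isNoetherian_of_linearEquiv Submodule.topEquiv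

/-- A Noetherian ring which is finite over a ring `B` is a Noetherian `B`-module. -/
theorem isNoetherian_of_finite_of_isNoetherianRing (B A : Type*) [CommRing B] [CommRing A]
    [Algebra B A] [Module.Finite B A] [IsNoetherianRing A] : IsNoetherian B A := by
  suffices H : ∀ J : Ideal A, IsNoetherian B (A ⧸ J) by
    have := H ⊥
    exact isNoetherian_of_linearEquiv (AlgEquiv.quotientBot B A).toLinearEquiv
  intro J
  induction J using WellFoundedGT.induction with
  | _ J ih =>
    refine isNoetherian_of_forall_isNoetherian_quotient_smul fun b hb => ?_
    have hbJ : algebraMap B A b ∉ J := by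
      refine fun hbJ => hb ((LinearMap.range_eq_bot).2 (LinearMap.ext fun x => ?_))
      obtain ⟨a, rfl⟩ := Ideal.Quotient.mk_surjective x
      change Ideal.Quotient.mk J (b • a) = 0
      rw [Ideal.Quotient.eq_zero_iff_mem, Algebra.smul_def]
      exact J.mul_mem_right a hbJ
    have := ih (J ⊔ Ideal.span {algebraMap B A b}) (by simpa [left_lt_sup] using hbJ)
    let f := (LinearMap.range (LinearMap.lsmul B (A ⧸ J) b)).mkQ ∘ₗ
      (Ideal.Quotient.mkₐ B J).toLinearMap
    have hf : Function.Surjective f :=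
      (Submodule.mkQ_surjective _).comp (Ideal.Quotient.mkₐ_surjective B J)
    have hker : (J ⊔ Ideal.span {algebraMap B A b}).restrictScalars B ≤ LinearMap.ker f := by
      intro x hx
      obtain ⟨y, hy, z, hz, rfl⟩ := Submodule.mem_sup.1 hx
      obtain ⟨a, rfl⟩ := Ideal.mem_span_singleton'.1 hz
      rw [LinearMap.mem_ker]
      refine (Submodule.Quotient.mk_eq_zero _).2 ⟨Ideal.Quotient.mk J a, ?_⟩
      change Ideal.Quotient.mk J (b • a) = Ideal.Quotient.mk J (y + a * algebraMap B A b)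
      rw [map_add, Ideal.Quotient.eq_zero_iff_mem.2 hy, zero_add, Algebra.smul_def, mul_comm]
    have : IsNoetherian B (A ⧸ (J ⊔ Ideal.span {algebraMap B A b}).restrictScalars B) := this
    refine isNoetherian_of_surjective (Submodule.liftQ _ f hker) ?_
    rw [Submodule.range_liftQ, LinearMap.range_eq_top.2 hf]

/-- The Eakin-Nagata theorem. -/
theorem isNoetherianRing_of_finite_of_injective (B A : Type*) [CommRing B] [CommRing A]
    [Algebra B A] [Module.Finite B A] [IsNoetherianRing A]
    (hBA : Function.Injective (algebraMap B A)) : IsNoetherianRing B := by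
  have := isNoetherian_of_finite_of_isNoetherianRing B A
  exact isNoetherian_of_injective (Algebra.linearMap B A) hBA

instance (G A : Type*) [Group G] [CommRing A] [IsLocalRing A] [MulSemiringAction G A] :
    IsLocalHom (fixedSubring G A).subtype where
  map_nonunit a ha := by
    obtain ⟨b, hb⟩ := isUnit_iff_exists_inv.1 ha
    refine isUnit_iff_exists_inv.2 ⟨⟨b, fun g => ha.mul_left_cancel ?_⟩, Subtype.ext hb⟩
    have h : g • ((a : A) * b) = g • (1 : A) := congrArg (g • ·) hb
    rw [smul_mul', a.2 g, smul_one] at h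
    exact h.trans hb.symm

theorem smul_mem_maximalIdeal_pow {G A : Type*} [Group G] [CommRing A] [IsLocalRing A]
    [MulSemiringAction G A] (g : G) {n : ℕ} {a : A} (ha : a ∈ maximalIdeal A ^ n) :
    g • a ∈ maximalIdeal A ^ n := by
  have h : maximalIdeal A ≤ (maximalIdeal A).comap (MulSemiringAction.toRingHom G A g) := by
    intro x hx
    rw [Ideal.mem_comap, mem_maximalIdeal, mem_nonunits_iff] at *
    intro hu
    refine hx ?_
    simpa using hu.map (MulSemiringAction.toRingHom G A g⁻¹)
  exact (Ideal.pow_right_mono h n).trans (Ideal.le_comap_pow _ n) ha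

theorem exists_maximalIdeal_pow_le_map (B A : Type*) [CommRing B] [CommRing A] [IsLocalRing B]
    [IsLocalRing A] [IsNoetherianRing A] [Algebra B A] [Algebra.IsIntegral B A] :
    ∃ r, maximalIdeal A ^ r ≤ (maximalIdeal B).map (algebraMap B A) := by
  refine Ideal.exists_pow_le_of_le_radical_of_fg ?_ (IsNoetherian.noetherian _)
  rw [Ideal.radical_eq_sInf]
  refine le_sInf fun P ⟨hP, hprime⟩ => ?_
  have hcomap : P.comap (algebraMap B A) = maximalIdeal B :=
    ((maximalIdeal.isMaximal B).eq_of_le (Ideal.IsPrime.under B P).ne_top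
      (Ideal.map_le_iff_le_comap.1 hP)).symm
  exact (eq_maximalIdeal (Ideal.isMaximal_of_isIntegral_of_isMaximal_comap (R := B) P
    (hcomap ▸ maximalIdeal.isMaximal B))).ge

/-- If `A` is finite over the subring `B`, the `maximalIdeal B`-adic topology on `B` is coarser than
the topology induced from `A`. -/
theorem exists_maximalIdeal_pow_comap_le (B A : Type*) [CommRing B] [CommRing A] [IsLocalRing B]
    [IsLocalRing A] [IsNoetherianRing A] [Algebra B A] [Module.Finite B A]
    (hBA : Function.Injective (algebraMap B A)) (n : ℕ) :
    ∃ N, (maximalIdeal A ^ N).comap (algebraMap B A) ≤ maximalIdeal B ^ n := by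
  have := isNoetherianRing_of_finite_of_injective B A hBA
  obtain ⟨r, hr⟩ := exists_maximalIdeal_pow_le_map B A
  obtain ⟨k, hk⟩ := (maximalIdeal B).exists_pow_inf_eq_pow_smul
    (LinearMap.range (Algebra.linearMap B A))
  refine ⟨r * (n + k), fun b hb => ?_⟩
  have hb' : algebraMap B A b ∈ (maximalIdeal B ^ (n + k) • ⊤ : Submodule B A) := by
    rw [Ideal.smul_top_eq_map, Submodule.restrictScalars_mem, Ideal.map_pow]
    exact Ideal.pow_right_mono hr _ (by rw [← pow_mul]; exact hb)
  have hb'' := (hk (n + k) (by lia)).le ⟨hb', b, rfl⟩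
  rw [Nat.add_sub_cancel] at hb''
  have : algebraMap B A b ∈ maximalIdeal B ^ n • LinearMap.range (Algebra.linearMap B A) :=
    Submodule.smul_mono le_rfl inf_le_right hb''
  rw [LinearMap.range_eq_map, ← Submodule.map_smul''] at this
  obtain ⟨c, hc, hcb⟩ := this
  obtain rfl := hBA hcb
  simpa using hc

/-- Let a finite group `G` act by ring automorphisms on a commutative
noetherian local ring `A` such that `A` is module finite over the fixed subring `A^G`.
If `A` is complete with respect to its maximal ideal, then `A^G` is a local ring that is
complete with respect to its maximal ideal. -/
theorem fixedSubring_complete (G A : Type*) [Group G] [Finite G] [CommRing A]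
    [IsLocalRing A] [IsNoetherianRing A] [MulSemiringAction G A]
    [Module.Finite (fixedSubring G A) A]
    (hA : IsAdicComplete (maximalIdeal A) A) :
    ∃ h : IsLocalRing (fixedSubring G A),
      IsAdicComplete (@maximalIdeal (fixedSubring G A) _ h) (fixedSubring G A) := by
  have hloc : IsLocalRing (fixedSubring G A) :=
    RingHom.domain_isLocalRing (fixedSubring G A).subtype
  refine ⟨hloc, ?_⟩
  have hm : maximalIdeal (fixedSubring G A) ≤
      (maximalIdeal A).comap (fixedSubring G A).subtype :=
    Ideal.map_le_iff_le_comap.1 (map_maximalIdeal_le _)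
  have hpow : ∀ n, ∀ b ∈ maximalIdeal (fixedSubring G A) ^ n, (b : A) ∈ maximalIdeal A ^ n :=
    fun n b hb => (Ideal.pow_right_mono hm n).trans (Ideal.le_comap_pow _ n) hb
  have hzero : ∀ a : A, (∀ n, a ∈ maximalIdeal A ^ n) → a = 0 := fun a ha =>
    IsHausdorff.haus' (I := maximalIdeal A) a fun n => by simpa [SModEq.zero] using ha n
  refine { haus' := fun x hx => ?_, prec' := fun f hf => ?_ }
  · refine Subtype.ext (hzero x fun n => hpow n x ?_)
    simpa [SModEq.zero] using hx n
  · simp only [SModEq.sub_mem, smul_eq_mul, Ideal.mul_top] at hf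
    obtain ⟨L, hL⟩ := IsPrecomplete.prec' (I := maximalIdeal A) (fun n => (f n : A))
      fun hmn => by simpa [SModEq.sub_mem] using hpow _ _ (hf hmn)
    simp only [SModEq.sub_mem, smul_eq_mul, Ideal.mul_top] at hL
    have hLfix : ∀ g : G, g • L = L := by
      refine fun g => sub_eq_zero.1 (hzero _ fun n => ?_)
      have h := sub_mem (hL n) (smul_mem_maximalIdeal_pow g (hL n))
      rw [smul_sub, (f n).2 g] at h
      simpa using h
    refine ⟨⟨L, hLfix⟩, fun n => ?_⟩
    simp only [SModEq.sub_mem, smul_eq_mul, Ideal.mul_top]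
    obtain ⟨N, hN⟩ := exists_maximalIdeal_pow_comap_le (fixedSubring G A) A
      Subtype.val_injective n
    have h : f (max n N) - ⟨L, hLfix⟩ ∈ maximalIdeal (fixedSubring G A) ^ n :=
      hN (Ideal.pow_le_pow_right (le_max_right n N) (hL (max n N)))
    simpa using add_mem (hf (le_max_left n N)) h
end

section
/- Let F be a field, let A be a commutative F-algebra of finite type, and let G be a finite group acting on A by F-algebra automorphisms. Then A is finitely generated as a module over the fixed subring A^G, and A^G is a finite type F-algebra. -/
/-- When `G` acts on the `F`-algebra `A` by `F`-algebra automorphisms (i.e. fixing the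
image of `F`), the fixed subring is an `F`-subalgebra. -/
def fixedSubalgebra (G F A : Type*) [Group G] [Field F] [CommRing A] [Algebra F A]
    [MulSemiringAction G A]
    (h : ∀ (g : G) (c : F), g • (algebraMap F A c) = algebraMap F A c) :
    Subalgebra F A :=
  { (fixedSubring G A).toSubsemiring with
    algebraMap_mem' := fun c g => h g c }

instance fixedSubalgebra_isInvariant (G F A : Type*) [Group G] [Field F] [CommRing A]
    [Algebra F A] [MulSemiringAction G A]
    (h : ∀ (g : G) (c : F), g • (algebraMap F A c) = algebraMap F A c) :
    Algebra.IsInvariant (fixedSubalgebra G F A h) A G :=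
  ⟨fun b hb => ⟨⟨b, hb⟩, rfl⟩⟩

theorem fixedSubalgebra_module_finite (G F A : Type*) [Group G] [Finite G] [Field F]
    [CommRing A] [Algebra F A] [MulSemiringAction G A] [Algebra.FiniteType F A]
    (h : ∀ (g : G) (c : F), g • (algebraMap F A c) = algebraMap F A c) :
    Module.Finite (fixedSubalgebra G F A h) A :=
  have : Algebra.IsIntegral (fixedSubalgebra G F A h) A :=
    Algebra.IsInvariant.isIntegral _ A G
  have : Algebra.FiniteType (fixedSubalgebra G F A h) A :=
    Algebra.FiniteType.of_restrictScalars_finiteType F _ A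
  Algebra.IsIntegral.finite

/-- Let `F` be a field, `A` a commutative `F`-algebra of finite type, and
`G` a finite group acting on `A` by `F`-algebra automorphisms.  Then `A` is finitely
generated as a module over the fixed subring `A^G`, and `A^G` is a finite type
`F`-algebra. -/
theorem fixedSubring_module_finite_and_finiteType
    (G F A : Type*) [Group G] [Finite G] [Field F] [CommRing A] [Algebra F A]
    [MulSemiringAction G A]
    (hFT : Algebra.FiniteType F A)
    (h : ∀ (g : G) (c : F), g • (algebraMap F A c) = algebraMap F A c) :
    Module.Finite (fixedSubring G A) A ∧
      Algebra.FiniteType F (fixedSubalgebra G F A h) := by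
  have hfin := fixedSubalgebra_module_finite G F A h
  exact ⟨hfin, ⟨fg_of_fg_of_fg F (fixedSubalgebra G F A h) A hFT.out hfin.fg_top
    Subtype.val_injective⟩⟩
end

section
/- Let R be a commutative noetherian henselian local ring and let C be an R-linear additive category (preadditive with finite biproducts) that is idempotent complete, such that for every object X of C the endomorphism ring End_C(X) is finitely generated as an R-module. Then C is a Krull–Schmidt category: every object of C is isomorphic to a finite biproduct of objects whose endomorphism rings E are nc local, i.e., E modulo its Jacobson radical is a division ring. -/
open CategoryTheory CategoryTheory.Limits

/-- The quotient of a ring by its Jacobson radical `J(E)` (the intersection of all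
maximal left ideals), formed via the corresponding two-sided ideal. -/
abbrev JacobsonQuotient (E : Type*) [Ring E] : Type _ :=
  ((⊥ : TwoSidedIdeal E).jacobson).ringCon.Quotient

/-- A (possibly noncommutative) ring is *nc local* if its quotient by the Jacobson
radical is a division ring. -/
def IsNcLocalRing (E : Type*) [Ring E] : Prop :=
  Nontrivial (JacobsonQuotient E) ∧ ∀ x : JacobsonQuotient E, x ≠ 0 → IsUnit x

section Henselian

open Polynomial IsLocalRing

variable {R : Type*} [CommRing R] [HenselianLocalRing R]

/-- Residue-field-valued points of an étale algebra over a henselian local ring lift. -/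
theorem HenselianLocalRing.exists_algHom_residue_comp_eq {S : Type*} [CommRing S] [Algebra R S]
    [Algebra.Etale R S] (φ : S →ₐ[R] ResidueField R) :
    ∃ σ : S →ₐ[R] R, (Algebra.ofId R (ResidueField R)).comp σ = φ := by
  let Q : Ideal S := RingHom.ker φ
  have : Q.IsPrime := RingHom.ker_isPrime _
  obtain ⟨f, hfQ, hf⟩ := Algebra.IsEtaleAt.exists_isStandardEtale (R := R) (S := S) Q
  obtain ⟨P⟩ := hf.nonempty_standardEtalePresentation
  let ψ : Localization.Away f →ₐ[R] ResidueField R :=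
    IsLocalization.Away.liftAlgHom f (f := φ) (isUnit_iff_ne_zero.mpr hfQ)
  have hψ : P.HasMap (ψ P.x) := P.hasMap.map ψ
  have hR : ∀ p : R[X], p.Monic → ∀ a₀ : ResidueField R, aeval a₀ p = 0 →
      aeval a₀ (derivative p) ≠ 0 → ∃ a : R, p.IsRoot a ∧ residue R a = a₀ :=
    ((HenselianLocalRing.TFAE R).out 0 1).mp ‹_›
  obtain ⟨a, ha, haψ⟩ := hR P.f P.monic_f (ψ P.x) hψ.1 hψ.isUnit_derivative_f.ne_zero
  have hga : P.HasMap a := by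
    refine ⟨by simpa [aeval_def] using ha, ?_⟩
    have h := hψ.2
    rw [← haψ, ← ResidueField.algebraMap_eq, aeval_algebraMap_apply] at h
    exact isUnit_of_map_unit (residue R) _ h
  let τ : Localization.Away f →ₐ[R] R := (P.P.lift a hga).comp P.equivRing.toAlgHom
  have hτ : (Algebra.ofId R (ResidueField R)).comp τ = ψ :=
    P.hom_ext (by simpa [τ, Algebra.ofId_apply] using haψ)
  refine ⟨τ.comp (IsScalarTower.toAlgHom R S _), ?_⟩
  rw [← AlgHom.comp_assoc, hτ]
  ext s
  simp [ψ]

/-- Coprime monic factorizations lift along the residue map of a henselian local ring. -/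
theorem HenselianLocalRing.exists_eq_mul_and_isCoprime_of_map_residue_eq_mul {p : R[X]}
    (hp : p.Monic) {f g : (ResidueField R)[X]} (hf : f.Monic) (hg : g.Monic)
    (h : p.map (residue R) = f * g) (hfg : IsCoprime f g) :
    ∃ f' g' : R[X], p = f' * g' ∧ IsCoprime f' g' ∧
      f'.map (residue R) = f ∧ g'.map (residue R) = g := by
  have hn : p.natDegree = f.natDegree + g.natDegree := by
    rw [← hf.natDegree_mul hg, ← h, hp.natDegree_map]
  let p' : MonicDegreeEq R p.natDegree := .mk p hp rfl
  let φ := (UniversalCoprimeFactorizationRing.homEquiv (ResidueField R) _ _ hn p').symm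
    ⟨(.mk f hf rfl, .mk g hg rfl), h.symm, hfg⟩
  obtain ⟨σ, hσ⟩ := exists_algHom_residue_comp_eq φ
  let q := UniversalCoprimeFactorizationRing.homEquiv R _ _ hn p' σ
  have hφ : UniversalCoprimeFactorizationRing.homEquiv (ResidueField R) _ _ hn p' φ =
    ⟨(.mk f hf rfl, .mk g hg rfl), h.symm, hfg⟩ := Equiv.apply_symm_apply _ _
  refine ⟨q.1.1.1, q.1.2.1, ?_, q.2.2, ?_, ?_⟩
  · simpa [p'] using q.2.1.symm
  · have := UniversalCoprimeFactorizationRing.homEquiv_comp_fst R _ _ hn p' σ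
      (Algebra.ofId R (ResidueField R))
    rw [hσ, hφ] at this
    exact congr(($this).1).symm
  · have := UniversalCoprimeFactorizationRing.homEquiv_comp_snd R _ _ hn p' σ
      (Algebra.ofId R (ResidueField R))
    rw [hσ, hφ] at this
    exact congr(($this).1).symm

/-- A nontrivial commutative integral algebra over a henselian local ring whose only idempotents
are `0` and `1` is local. -/
theorem HenselianLocalRing.isLocalRing_of_isIdempotentElem_of_commRing {A : Type*} [CommRing A]
    [Nontrivial A] [Algebra R A] [Algebra.IsIntegral R A]
    (hA : ∀ e : A, IsIdempotentElem e → e = 0 ∨ e = 1) :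
    IsLocalRing A := by
  refine .of_isUnit_or_isUnit_one_sub_self fun x ↦ ?_
  by_contra! ⟨hx₀, hx₁⟩
  obtain ⟨p, hp, hpx⟩ := Algebra.IsIntegral.isIntegral (R := R) x
  obtain ⟨g, hpg, hg⟩ := Polynomial.exists_eq_pow_rootMultiplicity_mul_and_not_dvd
    (p.map (residue R)) (hp.map _).ne_zero 0
  set a := rootMultiplicity 0 (p.map (residue R))
  rw [C_0, sub_zero] at hpg hg
  have hXa : (X ^ a : (ResidueField R)[X]).Monic := monic_X_pow a
  obtain ⟨f', g', rfl, ⟨u, v, huv⟩, hf', hg'⟩ :=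
    exists_eq_mul_and_isCoprime_of_map_residue_eq_mul hp hXa
      (hXa.of_mul_monic_left (hpg ▸ hp.map _)) hpg
      (((prime_X (R := ResidueField R)).coprime_iff_not_dvd.mpr hg).pow_left)
  have hfg : aeval x f' * aeval x g' = 0 := by simpa [aeval_def] using hpx
  have huv' : aeval x u * aeval x f' + aeval x v * aeval x g' = 1 := by
    simpa using congr(aeval x $huv)
  -- at a maximal ideal of `A`, polynomials are evaluated through their reductions over `k`
  have key (M : Ideal A) (hM : M.IsMaximal) : ∃ i : ResidueField R →+* A ⧸ M, ∀ q : R[X],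
      Ideal.Quotient.mk M (aeval x q) = (q.map (residue R)).eval₂ i (Ideal.Quotient.mk M x) := by
    have hM' : (M.comap (algebraMap R A)).IsMaximal :=
      Ideal.isMaximal_comap_of_isIntegral_of_isMaximal M
    obtain ⟨i, hi⟩ : ∃ i : ResidueField R →+* A ⧸ M,
        i.comp (residue R) = (Ideal.Quotient.mk M).comp (algebraMap R A) := by
      refine ⟨Ideal.Quotient.lift (maximalIdeal R) _ fun r hr ↦ ?_, Ideal.Quotient.lift_comp_mk ..⟩
      rw [← eq_maximalIdeal hM', Ideal.mem_comap] at hr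
      exact Ideal.Quotient.eq_zero_iff_mem.mpr hr
    exact ⟨i, fun q ↦ by rw [eval₂_map, hi, aeval_def, hom_eval₂]⟩
  obtain ⟨M₀, hM₀, hxM₀⟩ := exists_max_ideal_of_mem_nonunits hx₀
  obtain ⟨M₁, hM₁, hxM₁⟩ := exists_max_ideal_of_mem_nonunits hx₁
  have hmk₀ : Ideal.Quotient.mk M₀ x = 0 := Ideal.Quotient.eq_zero_iff_mem.mpr hxM₀
  have hmk₁ : Ideal.Quotient.mk M₁ x = 1 :=
    (sub_eq_zero.mp (by simpa using Ideal.Quotient.eq_zero_iff_mem.mpr hxM₁)).symm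
  obtain ⟨i, hi⟩ := key M₀ hM₀
  obtain ⟨j, hj⟩ := key M₁ hM₁
  have hf₁ : Ideal.Quotient.mk M₁ (aeval x f') = 1 := by simp [hj, hf', hmk₁]
  have hg₀ : Ideal.Quotient.mk M₀ (aeval x g') ≠ 0 := by
    rw [hi, hg', hmk₀, eval₂_at_zero, _root_.map_ne_zero]
    rwa [X_dvd_iff] at hg
  rcases hA (aeval x u * aeval x f') (by
    unfold IsIdempotentElem
    linear_combination (aeval x u * aeval x f') * huv' - aeval x u * aeval x v * hfg) with h | h
  · have : aeval x f' = 0 := by linear_combination (aeval x f') * (- huv' + h) + aeval x v * hfg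
    simp [this] at hf₁
  · have : aeval x g' = 0 := by linear_combination (- aeval x g') * h + aeval x u * hfg
    simp [this] at hg₀

/-- A nontrivial integral algebra, possibly noncommutative, over a henselian local ring whose only
idempotents are `0` and `1` is local. -/
theorem HenselianLocalRing.isLocalRing_of_isIdempotentElem (R : Type*) [CommRing R]
    [HenselianLocalRing R] {E : Type*} [Ring E] [Nontrivial E] [Algebra R E]
    [Algebra.IsIntegral R E] (hE : ∀ e : E, IsIdempotentElem e → e = 0 ∨ e = 1) :
    IsLocalRing E := by
  refine ⟨fun {a b} hab ↦ ?_⟩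
  let A := Algebra.adjoin R {a}
  have : Algebra.IsIntegral R A := ⟨fun x ↦ (isIntegral_algHom_iff A.val Subtype.val_injective).mp
    (Algebra.IsIntegral.isIntegral x.1)⟩
  have : IsLocalRing A :=
    HenselianLocalRing.isLocalRing_of_isIdempotentElem_of_commRing (R := R) fun e he ↦
    (hE e (he.map A.val)).imp Subtype.ext Subtype.ext
  let x : A := ⟨a, Algebra.self_mem_adjoin_singleton R a⟩
  have hb : b = A.val (1 - x) := by simp [x, ← hab]
  rw [hb]
  exact (IsLocalRing.isUnit_or_isUnit_of_add_one (add_sub_cancel x 1)).imp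
    (IsUnit.map A.val) (IsUnit.map A.val)

end Henselian

/-- In a local ring, possibly noncommutative, left inverses are two-sided. -/
theorem IsLocalRing.isUnit_of_mul_eq_one_left {E : Type*} [Ring E] [IsLocalRing E] {a b : E}
    (h : a * b = 1) : IsUnit b := by
  suffices h' : b * a = 1 from ⟨⟨b, a, h', h⟩, rfl⟩
  have he : b * a * (b * a) = b * a := by rw [mul_assoc, ← mul_assoc a, h, one_mul]
  rcases IsLocalRing.isUnit_or_isUnit_of_add_one (add_sub_cancel (b * a) 1) with hu | hu
  · exact hu.mul_left_cancel (by rw [he, mul_one])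
  · have hba : b * a = 0 := hu.mul_left_cancel (by rw [sub_mul, one_mul, he, sub_self, mul_zero])
    have hb : b = 0 := by rw [← mul_one b, ← h, ← mul_assoc, hba, zero_mul]
    exact absurd h (by simp [hb])

/-- A ring in which `x` or `1 - x` is always a unit has a division ring as its quotient by the
Jacobson radical. -/
theorem IsLocalRing.isNcLocalRing (E : Type*) [Ring E] [IsLocalRing E] : IsNcLocalRing E := by
  have mk_eq_zero (x : E) : (x : JacobsonQuotient E) = 0 ↔ x ∈ (⊥ : TwoSidedIdeal E).jacobson := by
    rw [TwoSidedIdeal.mem_iff]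
    exact RingCon.eq _
  refine ⟨nontrivial_of_ne 1 0 fun h ↦ ?_, fun x hx ↦ ?_⟩
  · obtain ⟨z, hz⟩ := TwoSidedIdeal.mem_jacobson_iff.mp ((mk_eq_zero 1).mp h) (-1)
    simp [TwoSidedIdeal.mem_bot] at hz
  · obtain ⟨x, rfl⟩ := RingCon.mk'_surjective _ x
    have hx' : x ∉ (⊥ : TwoSidedIdeal E).jacobson := fun h ↦ hx ((mk_eq_zero x).mpr h)
    simp only [TwoSidedIdeal.mem_jacobson_iff, TwoSidedIdeal.mem_bot, not_forall,
      not_exists] at hx'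
    obtain ⟨y, hy⟩ := hx'
    refine IsUnit.map (RingCon.mk' _) ?_
    rcases IsLocalRing.isUnit_or_isUnit_of_add_one (neg_add_cancel_comm_assoc (y * x) 1)
      with hu | hu
    · obtain ⟨u, hu⟩ := hu.neg
      rw [neg_neg] at hu
      exact IsLocalRing.isUnit_of_mul_eq_one_left (a := ↑u⁻¹ * y)
        (by rw [mul_assoc, ← hu, u.inv_mul])
    · obtain ⟨u, hu⟩ := hu
      refine absurd ?_ (hy ↑u⁻¹)
      rw [mul_assoc, ← mul_add_one, add_comm, ← hu, u.inv_mul, sub_self]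

section Decomposition

variable {C : Type*} [Category* C] [Preadditive C] [HasFiniteBiproducts C]

/-- `X` is a finite biproduct of objects satisfying `P`. -/
def CategoryTheory.ObjectProperty.IsFiniteBiproduct (P : ObjectProperty C) (X : C) : Prop :=
  ∃ (J : Type) (_ : Finite J) (f : J → C), (∀ j, P (f j)) ∧ Nonempty (X ≅ ⨁ f)

theorem CategoryTheory.ObjectProperty.IsFiniteBiproduct.biproduct {P : ObjectProperty C}
    {J : Type} [Finite J] {X : J → C} (h : ∀ j, P.IsFiniteBiproduct (X j)) :
    P.IsFiniteBiproduct (⨁ X) := by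
  choose K _ f hf e using h
  exact ⟨Σ j, K j, inferInstance, fun k ↦ f k.1 k.2, fun k ↦ hf k.1 k.2,
    ⟨biproduct.mapIso (fun j ↦ (e j).some) ≪≫ biproductBiproductIso _ _⟩⟩

theorem CategoryTheory.ObjectProperty.IsFiniteBiproduct.of_iso {P : ObjectProperty C} {X Y : C}
    (h : P.IsFiniteBiproduct X) (e : Y ≅ X) : P.IsFiniteBiproduct Y := by
  obtain ⟨J, _, f, hf, ⟨e'⟩⟩ := h
  exact ⟨J, inferInstance, f, hf, ⟨e ≪≫ e'⟩⟩

theorem CategoryTheory.ObjectProperty.IsFiniteBiproduct.exists_fin {P : ObjectProperty C} {X : C}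
    (h : P.IsFiniteBiproduct X) :
    ∃ (n : ℕ) (f : Fin n → C), (∀ i, P (f i)) ∧ Nonempty (X ≅ ⨁ f) := by
  obtain ⟨J, _, f, hf, ⟨e⟩⟩ := h
  let σ := (Finite.equivFin J).symm
  exact ⟨_, f ∘ σ, fun i ↦ hf _, ⟨e ≪≫ (biproduct.reindex σ f).symm⟩⟩

theorem CategoryTheory.ObjectProperty.IsFiniteBiproduct.of_isZero {P : ObjectProperty C} {X : C}
    (h : IsZero X) : P.IsFiniteBiproduct X :=
  ⟨PEmpty, inferInstance, PEmpty.elim, fun j ↦ j.elim,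
    ⟨h.iso ((IsZero.iff_id_eq_zero _).mpr (biproduct.hom_ext _ _ (fun j ↦ j.elim)))⟩⟩

theorem CategoryTheory.ObjectProperty.IsFiniteBiproduct.of_prop {P : ObjectProperty C} {X : C}
    (h : P X) : P.IsFiniteBiproduct X :=
  ⟨PUnit, inferInstance, fun _ ↦ X, fun _ ↦ h, ⟨(biproductUniqueIso fun _ ↦ X).symm⟩⟩

/-- The splittings of an idempotent `p` and of `𝟙 X - p` decompose `X`. -/
theorem CategoryTheory.Idempotents.exists_iso_biproduct_of_idem [IsIdempotentComplete C]
    {X : C} (p : X ⟶ X)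
    (hp : p ≫ p = p) : ∃ (Y : Bool → C) (i : ∀ b, Y b ⟶ X) (r : ∀ b, X ⟶ Y b),
      (∀ b, i b ≫ r b = 𝟙 _) ∧ (∀ b, r b ≫ i b = bif b then p else 𝟙 X - p) ∧
      Nonempty (X ≅ ⨁ Y) := by
  have hq := Idempotents.idem_of_id_sub_idem p hp
  choose Y i r hir hri using fun b : Bool ↦
    IsIdempotentComplete.idempotents_split X (bif b then p else 𝟙 X - p) (by cases b <;> assumption)
  refine ⟨Y, i, r, hir, hri, ⟨⟨biproduct.lift r, biproduct.desc i, ?_, ?_⟩⟩⟩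
  · simp [biproduct.lift_desc, hri]
  · have hi (b b' : Bool) (hb : b ≠ b') : i b ≫ r b' = 0 := by
      have h : (r b ≫ i b) ≫ r b' ≫ i b' = 0 := by
        rw [hri, hri]
        cases b <;> cases b' <;> simp_all
      calc i b ≫ r b' = i b ≫ ((r b ≫ i b) ≫ r b' ≫ i b') ≫ r b' := by
            simp [hir, reassoc_of% hir]
        _ = 0 := by simp [h]
    ext b b'
    by_cases hb : b = b'
    · subst hb
      simp [hir]
    · simp [hi b' b (Ne.symm hb), biproduct.ι_π_ne _ (Ne.symm hb)]

/-- An object with noetherian endomorphism ring in an idempotent complete category is a finite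
biproduct of nonzero objects without nontrivial idempotents. -/
theorem CategoryTheory.ObjectProperty.isFiniteBiproduct_of_isNoetherian (R : Type*) [Ring R]
    [Linear R C] [IsIdempotentComplete C] {P : ObjectProperty C}
    (hP : ∀ Y : C, ¬ IsZero Y → (∀ p : Y ⟶ Y, p ≫ p = p → p = 0 ∨ p = 𝟙 Y) → P Y)
    (X : C) [IsNoetherian R (X ⟶ X)] : P.IsFiniteBiproduct X := by
  suffices ∀ (N : Submodule R (X ⟶ X)) (Y : C) (i : Y ⟶ X) (r : X ⟶ Y), i ≫ r = 𝟙 Y →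
      N = LinearMap.ker (Linear.rightComp R X r) → P.IsFiniteBiproduct Y from
    this _ X (𝟙 X) (𝟙 X) (by simp) rfl
  intro N
  induction N using WellFoundedGT.induction with
  | ind N ih =>
  rintro Y i r hir rfl
  by_cases hY : IsZero Y
  · exact .of_isZero hY
  by_cases hp : ∀ p : Y ⟶ Y, p ≫ p = p → p = 0 ∨ p = 𝟙 Y
  · exact .of_prop (hP Y hY hp)
  push Not at hp
  obtain ⟨p, hp, hp₀, hp₁⟩ := hp
  obtain ⟨Z, j, s, hjs, hsj, ⟨e⟩⟩ := Idempotents.exists_iso_biproduct_of_idem p hp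
  refine .of_iso (.biproduct fun b ↦ ih _ ?_ (Z b) (j b ≫ i) (r ≫ s b) ?_ rfl) e
  · refine lt_of_le_of_ne (fun f hf ↦ ?_) fun h ↦ ?_
    · simp only [LinearMap.mem_ker, Linear.rightComp_apply] at hf ⊢
      rw [reassoc_of% hf, zero_comp]
    · have hmem : r ≫ (𝟙 Y - s b ≫ j b) ≫ i ∈ LinearMap.ker (Linear.rightComp R X (r ≫ s b)) := by
        simp [reassoc_of% hir, hjs]
      rw [← h, LinearMap.mem_ker, Linear.rightComp_apply] at hmem
      have hs : 𝟙 Y - s b ≫ j b = 0 := by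
        simpa only [Category.assoc, hir, reassoc_of% hir, Category.comp_id, comp_zero] using
          congr(i ≫ $hmem)
      rw [hsj] at hs
      cases b
      · exact hp₀ (by simpa using hs)
      · exact hp₁ (sub_eq_zero.mp hs).symm
  · simp [reassoc_of% hir, hjs]

end Decomposition

/-- Let `R` be a commutative noetherian henselian local ring and let `C`
be an `R`-linear additive category that is idempotent complete, such that for every
object `X` the endomorphism ring `End X` is finitely generated as an `R`-module.  Then
`C` is a Krull–Schmidt category: every object is isomorphic to a finite biproduct of
objects whose endomorphism rings are nc local. -/
theorem krullSchmidt_of_henselian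
    (R : Type*) [CommRing R] [IsNoetherianRing R] [HenselianLocalRing R]
    (C : Type*) [Category C] [Preadditive C] [HasFiniteBiproducts C]
    [CategoryTheory.Linear R C] [IsIdempotentComplete C]
    (hfin : ∀ X : C, Module.Finite R (End X)) :
    ∀ X : C, ∃ (n : ℕ) (f : Fin n → C),
      (∀ i, IsNcLocalRing (End (f i))) ∧ Nonempty (X ≅ ⨁ f) := by
  intro X
  have : IsNoetherian R (X ⟶ X) := isNoetherian_of_isNoetherianRing_of_finite R (End X)
  refine (ObjectProperty.isFiniteBiproduct_of_isNoetherian R (P := fun Y ↦ IsNcLocalRing (End Y))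
    (fun Y hY hp ↦ ?_) X).exists_fin
  have : Nontrivial (End Y) :=
    nontrivial_of_ne 1 0 fun h ↦ hY ((IsZero.iff_id_eq_zero _).mpr h)
  have := hfin Y
  have := HenselianLocalRing.isLocalRing_of_isIdempotentElem R (E := End Y) hp
  exact IsLocalRing.isNcLocalRing _
end

section
/- Let R be a commutative noetherian henselian local ring and let E be an associative (possibly noncommutative) R-algebra that is nontrivial, finitely generated as an R-module, and whose only idempotent elements are 0 and 1. Then E/J(E) is a division ring, where J(E) denotes the Jacobson radical of E. -/
open Polynomial IsLocalRing

/-- Over a henselian local ring, every residue-field valued point of an étale algebra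
lifts to a rational point. -/
theorem HenselianLocalRing.exists_algHom_lift_of_etale
    {R S : Type*} [CommRing R] [HenselianLocalRing R] [CommRing S] [Algebra R S]
    [Algebra.Etale R S] (φ : S →ₐ[R] ResidueField R) :
    ∃ ψ : S →ₐ[R] R, (Algebra.ofId R (ResidueField R)).comp ψ = φ := by
  let Q : Ideal S := RingHom.ker φ.toRingHom
  have : Q.IsPrime := RingHom.ker_isPrime _
  obtain ⟨s, hsQ, ⟨⟨P⟩⟩⟩ := Algebra.IsEtaleAt.exists_isStandardEtale (R := R) Q
  have hs : IsUnit (φ s) := isUnit_iff_ne_zero.mpr hsQ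
  let φ' : Localization.Away s →ₐ[R] ResidueField R :=
    IsLocalization.Away.liftAlgHom (f := φ) s hs
  have hφ' : φ'.comp (IsScalarTower.toAlgHom R S (Localization.Away s)) = φ := by
    ext; simp [φ']
  have hx : P.HasMap (φ' P.x) := P.hasMap.map φ'
  have htfae := (HenselianLocalRing.TFAE R).out 0 1
  obtain ⟨a, ha, hax⟩ := htfae.mp inferInstance P.f P.monic_f (φ' P.x)
    hx.1 hx.isUnit_derivative_f.ne_zero
  have hag : P.HasMap a := by
    refine ⟨by simpa [IsRoot] using ha, ?_⟩
    have := hx.2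
    rw [← hax, ← ResidueField.algebraMap_eq, aeval_algebraMap_apply] at this
    exact isUnit_of_map_unit (residue R) _ this
  refine ⟨((P.lift a hag).comp P.equivRing.toAlgHom).comp
    (IsScalarTower.toAlgHom R S (Localization.Away s)), ?_⟩
  rw [← hφ', ← AlgHom.comp_assoc]
  congr 1
  apply P.hom_ext
  simpa [Algebra.ofId_apply] using hax

/-- Over a henselian local ring, coprime monic factorizations lift from the residue field. -/
theorem HenselianLocalRing.exists_monic_mul_eq_of_isCoprime
    {R : Type*} [CommRing R] [HenselianLocalRing R] {p : R[X]} (hp : p.Monic)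
    {f g : (ResidueField R)[X]} (hf : f.Monic) (hg : g.Monic)
    (h : p.map (residue R) = f * g) (hfg : IsCoprime f g) :
    ∃ f' g' : R[X], f' * g' = p ∧ IsCoprime f' g' ∧
      f'.map (residue R) = f ∧ g'.map (residue R) = g := by
  have hn : p.natDegree = f.natDegree + g.natDegree := by
    rw [← hp.natDegree_map (residue R), h, hf.natDegree_mul hg]
  let e (T : Type _) [CommRing T] [Algebra R T] :=
    UniversalCoprimeFactorizationRing.homEquiv T f.natDegree g.natDegree hn (.mk p hp rfl)
  let φ := (e (ResidueField R)).symm ⟨(.mk f hf rfl, .mk g hg rfl), h.symm, hfg⟩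
  obtain ⟨ψ, hψ⟩ := HenselianLocalRing.exists_algHom_lift_of_etale φ
  refine ⟨(e R ψ).1.1.1, (e R ψ).1.2.1, ?_, (e R ψ).2.2, ?_, ?_⟩
  · simpa [MonicDegreeEq.mk] using (e R ψ).2.1
  · have := UniversalCoprimeFactorizationRing.homEquiv_comp_fst _ f.natDegree g.natDegree hn
      (.mk p hp rfl) ψ (Algebra.ofId R (ResidueField R))
    rw [hψ] at this
    have hφ : (e _ φ).1.1.1 = f := by rw [(e _).apply_symm_apply]; rfl
    exact congr(($this).1).symm.trans hφ
  · have := UniversalCoprimeFactorizationRing.homEquiv_comp_snd _ f.natDegree g.natDegree hn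
      (.mk p hp rfl) ψ (Algebra.ofId R (ResidueField R))
    rw [hψ] at this
    have hφ : (e _ φ).1.2.1 = g := by rw [(e _).apply_symm_apply]; rfl
    exact congr(($this).1).symm.trans hφ

/-- If `p` kills `x` and `p c` is a unit, then `x - c` is a unit. -/
theorem Polynomial.isUnit_sub_algebraMap_of_aeval_eq_zero
    {R E : Type*} [CommRing R] [Ring E] [Algebra R E] {x : E} {p : R[X]} {c : R}
    (hp : aeval x p = 0) (hc : IsUnit (p.eval c)) : IsUnit (x - algebraMap R E c) := by
  obtain ⟨q, hq⟩ := X_sub_C_dvd_sub_C_eval (a := c) (p := p)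
  obtain ⟨u, hu⟩ := hc
  have key : (X - C c) * (q * C (-(↑u⁻¹ : R))) = 1 - p * C (↑u⁻¹ : R) := by
    have : (C (↑u : R) : R[X]) * C (↑u⁻¹ : R) = 1 := by rw [← C_mul, u.mul_inv, C_1]
    rw [← mul_assoc, ← hq, ← hu, C_neg]
    linear_combination this
  have h₁ := congr(aeval x $key)
  have h₂ := congr(aeval x $((mul_comm _ _).trans key))
  simp only [map_mul (aeval x), map_sub, map_one, hp, zero_mul, sub_zero, aeval_X, aeval_C]
    at h₁ h₂
  exact isUnit_iff_exists.mpr ⟨_, h₁, by simpa using h₂⟩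

/-- An algebra without nontrivial idempotents, integral over a henselian local ring, is local. -/
theorem HenselianLocalRing.isLocalRing_of_isIntegral
    (R : Type*) {E : Type*} [CommRing R] [HenselianLocalRing R]
    [Ring E] [Nontrivial E] [Algebra R E] [Algebra.IsIntegral R E]
    (hidem : ∀ e : E, IsIdempotentElem e → e = 0 ∨ e = 1) : IsLocalRing E := by
  refine .of_isUnit_or_isUnit_one_sub_self fun x ↦ ?_
  obtain ⟨p, hp, hpx⟩ := Algebra.IsIntegral.isIntegral (R := R) x
  rw [← aeval_def] at hpx
  have hp0 : p.map (residue R) ≠ 0 := (hp.map _).ne_zero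
  obtain ⟨g, hg, hXg⟩ := exists_eq_pow_rootMultiplicity_mul_and_not_dvd _ hp0 0
  rw [C_0, sub_zero] at hg hXg
  set k := rootMultiplicity 0 (p.map (residue R))
  have hgm : g.Monic := (monic_X_pow k).of_mul_monic_left (hg ▸ hp.map _)
  obtain ⟨f₁, f₂, hf, ⟨a, b, hab⟩, h₁, h₂⟩ :=
    HenselianLocalRing.exists_monic_mul_eq_of_isCoprime hp (monic_X_pow k) hgm hg
      ((irreducible_X.coprime_iff_not_dvd.mpr hXg).pow_left)
  have hsum : aeval x (a * f₁) + aeval x (b * f₂) = 1 := by rw [← map_add, hab, map_one]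
  have hcross : aeval x (a * f₁) * aeval x (b * f₂) = 0 := by
    rw [← map_mul, show a * f₁ * (b * f₂) = a * b * p by rw [← hf]; ring, map_mul, hpx, mul_zero]
  have he : IsIdempotentElem (aeval x (a * f₁)) := by
    rw [IsIdempotentElem]
    nth_rw 2 [eq_sub_of_add_eq hsum]
    rw [mul_sub, hcross, mul_one, sub_zero]
  rcases hidem _ he with h | h
  · right
    have hf₁ : aeval x f₁ = 0 := by
      rw [h, zero_add, map_mul] at hsum
      rw [← mul_one (aeval x f₁), ← hsum, ← map_mul, ← map_mul,
        show f₁ * (b * f₂) = b * p by rw [← hf]; ring, map_mul, hpx, mul_zero]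
    have hu : IsUnit (f₁.eval 1) := by
      refine isUnit_of_map_unit (residue R) _ ?_
      rw [← eval_map_apply, h₁]
      simp
    simpa using (isUnit_sub_algebraMap_of_aeval_eq_zero hf₁ hu).neg
  · left
    have hf₂ : aeval x f₂ = 0 := by
      rw [← mul_one (aeval x f₂), ← h, ← map_mul,
        show f₂ * (a * f₁) = a * p by rw [← hf]; ring, map_mul, hpx, mul_zero]
    have hu : IsUnit (f₂.eval 0) := by
      refine isUnit_of_map_unit (residue R) _ ?_
      rw [← eval_map_apply, h₂, map_zero, isUnit_iff_ne_zero, ← coeff_zero_eq_eval_zero]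
      exact fun h0 ↦ hXg (X_dvd_iff.mpr h0)
    simpa using isUnit_sub_algebraMap_of_aeval_eq_zero hf₂ hu

/-- In a local ring without nontrivial idempotents, elements outside the Jacobson radical are
units. -/
theorem IsLocalRing.isUnit_of_notMem_jacobson {E : Type*} [Ring E] [IsLocalRing E]
    (hidem : ∀ e : E, IsIdempotentElem e → e = 0 ∨ e = 1) {y : E}
    (hy : y ∉ (⊥ : TwoSidedIdeal E).jacobson) : IsUnit y := by
  rw [TwoSidedIdeal.mem_jacobson_iff] at hy
  push Not at hy
  obtain ⟨r, hr⟩ := hy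
  have hnot : ¬ IsUnit (1 + r * y) := by
    rintro ⟨u, hu⟩
    apply hr ↑u⁻¹
    have : (↑u⁻¹ : E) * (1 + r * y) = 1 := by rw [← hu, u.inv_mul]
    rw [TwoSidedIdeal.mem_bot, sub_eq_zero, ← this]
    noncomm_ring
  obtain ⟨u, hu⟩ := (IsLocalRing.isUnit_or_isUnit_of_add_one
    (show (1 + r * y) + -(r * y) = 1 by abel)).resolve_left hnot
  set v : E := -(↑u⁻¹ * r)
  have hv : v * y = 1 := by
    rw [← u.inv_mul, hu]
    simp [v, mul_assoc]
  have he : IsIdempotentElem (y * v) := by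
    rw [IsIdempotentElem, mul_assoc, ← mul_assoc v, hv, one_mul]
  rcases hidem _ he with h | h
  · have : y = 0 := by rw [← mul_one y, ← hv, ← mul_assoc, h, zero_mul]
    simp [this] at hv
  · exact isUnit_iff_exists.mpr ⟨v, h, hv⟩

/-- Let `R` be a commutative noetherian henselian local ring and let `E`
be an associative (possibly noncommutative) `R`-algebra that is nontrivial, finitely
generated as an `R`-module, and whose only idempotent elements are `0` and `1`.  Then
`E/J(E)` is a division ring. -/
theorem jacobsonQuotient_divisionRing_of_no_nontrivial_idempotents
    (R E : Type*) [CommRing R] [IsNoetherianRing R] [HenselianLocalRing R]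
    [Ring E] [Nontrivial E] [Algebra R E] [Module.Finite R E]
    (hidem : ∀ e : E, IsIdempotentElem e → e = 0 ∨ e = 1) :
    Nontrivial (JacobsonQuotient E) ∧
      ∀ x : JacobsonQuotient E, x ≠ 0 → IsUnit x := by
  have : IsLocalRing E := HenselianLocalRing.isLocalRing_of_isIntegral R hidem
  let J : TwoSidedIdeal E := (⊥ : TwoSidedIdeal E).jacobson
  have hzero (y : E) : J.ringCon.mk' y = 0 ↔ y ∈ J := by
    rw [← map_zero J.ringCon.mk', TwoSidedIdeal.mem_iff]
    exact RingCon.eq _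
  refine ⟨⟨1, 0, fun h ↦ ?_⟩, fun x hx ↦ ?_⟩
  · rw [← map_one J.ringCon.mk', hzero, TwoSidedIdeal.mem_jacobson_iff] at h
    obtain ⟨z, hz⟩ := h (-1)
    simp [TwoSidedIdeal.mem_bot] at hz
  · obtain ⟨y, rfl⟩ := J.ringCon.mk'_surjective x
    exact (IsLocalRing.isUnit_of_notMem_jacobson hidem (mt (hzero y).mpr hx)).map J.ringCon.mk'
end

section
/- Let C be an additive category (preadditive with finite biproducts) such that for every object X the endomorphism ring End_C(X) is a noetherian ring. Then every object of C is isomorphic to a finite biproduct of indecomposable objects (where the zero object is the empty biproduct). -/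
open CategoryTheory CategoryTheory.Limits

section Biproducts

variable {C : Type*} [Category C] [Preadditive C]

/-- A finite biproduct over a sum of index types is a binary biproduct of finite biproducts. -/
noncomputable def biproductSumIso [HasFiniteBiproducts C] [HasBinaryBiproducts C]
    {J K : Type*} [Finite J] [Finite K] (f : J ⊕ K → C) :
    (⨁ f) ≅ (⨁ fun j => f (Sum.inl j)) ⊞ (⨁ fun k => f (Sum.inr k)) where
  hom := biprod.lift (biproduct.lift fun j => biproduct.π f (Sum.inl j))
    (biproduct.lift fun k => biproduct.π f (Sum.inr k))
  inv := biproduct.lift (fun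
    | Sum.inl j => biprod.fst ≫ biproduct.π (fun j => f (Sum.inl j)) j
    | Sum.inr k => biprod.snd ≫ biproduct.π (fun k => f (Sum.inr k)) k)
  hom_inv_id := by
    apply biproduct.hom_ext
    rintro (j | k) <;> simp
  inv_hom_id := by
    apply biprod.hom_ext <;> apply biproduct.hom_ext <;> intro <;> simp

/-- The left ideal of endomorphisms of `X` that vanish after precomposition with `i`. -/
def precompAnnihilator {X Y : C} (i : Y ⟶ X) : Ideal (End X) where
  carrier := {f | i ≫ f.asHom = 0}
  zero_mem' := comp_zero
  add_mem' {a b} ha hb := by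
    change i ≫ (a.asHom + b.asHom) = 0
    rw [Preadditive.comp_add]
    exact (congrArg₂ (· + ·) ha hb).trans (add_zero 0)
  smul_mem' c f hf := by
    change i ≫ f.asHom ≫ c.asHom = 0
    rw [← Category.assoc, show i ≫ f.asHom = 0 from hf, zero_comp]

theorem mem_precompAnnihilator {X Y : C} {i : Y ⟶ X} {f : X ⟶ X} :
    End.of f ∈ precompAnnihilator i ↔ i ≫ f = 0 :=
  Iff.rfl

/-- If `i` is a retract inclusion, restricting it along `a` strictly enlarges the annihilator as
soon as some nonzero endomorphism of the retract vanishes on `a`. -/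
theorem precompAnnihilator_lt_comp {X Y A : C} (h : Retract Y X) (a : A ⟶ Y) (e : Y ⟶ Y)
    (hae : a ≫ e = 0) (he : e ≠ 0) :
    precompAnnihilator h.i < precompAnnihilator (a ≫ h.i) := by
  refine SetLike.lt_iff_le_and_exists.2 ⟨fun f hf => ?_, End.of (h.r ≫ e ≫ h.i), ?_, ?_⟩
  · change (a ≫ h.i) ≫ f.asHom = 0
    rw [Category.assoc, show h.i ≫ f.asHom = 0 from hf, comp_zero]
  · rw [mem_precompAnnihilator]
    rw [Category.assoc, h.retract_assoc, ← Category.assoc, hae, zero_comp]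
  · rw [mem_precompAnnihilator]
    intro h0
    apply he
    simpa using h0 =≫ h.r

variable [HasFiniteBiproducts C] [HasBinaryBiproducts C]

/-- An object is a finite biproduct of indecomposables. -/
def IsFiniteBiproductOfIndecomposables (X : C) : Prop :=
  ∃ (n : ℕ) (f : Fin n → C), (∀ i, Indecomposable (f i)) ∧ Nonempty (X ≅ ⨁ f)

namespace IsFiniteBiproductOfIndecomposables

theorem of_isZero {X : C} (hX : IsZero X) : IsFiniteBiproductOfIndecomposables X :=
  ⟨0, Fin.elim0, fun i => i.elim0, ⟨hX.iso <| by
    rw [IsZero.iff_id_eq_zero]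
    exact biproduct.hom_ext _ _ fun i => i.elim0⟩⟩

theorem of_indecomposable {X : C} (hX : Indecomposable X) :
    IsFiniteBiproductOfIndecomposables X :=
  ⟨1, fun _ => X, fun _ => hX, ⟨(biproductUniqueIso fun _ : Fin 1 => X).symm⟩⟩

theorem of_iso_biprod {X A B : C} (e : X ≅ A ⊞ B) (hA : IsFiniteBiproductOfIndecomposables A)
    (hB : IsFiniteBiproductOfIndecomposables B) : IsFiniteBiproductOfIndecomposables X := by
  obtain ⟨m, f, hf, ⟨φ⟩⟩ := hA
  obtain ⟨n, g, hg, ⟨ψ⟩⟩ := hB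
  refine ⟨m + n, Sum.elim f g ∘ finSumFinEquiv.symm, fun i => ?_,
    ⟨e ≪≫ biprod.mapIso φ ψ ≪≫ (biproductSumIso (Sum.elim f g)).symm ≪≫
      biproduct.whiskerEquiv finSumFinEquiv fun j => eqToIso (by simp)⟩⟩
  rcases h : finSumFinEquiv.symm i with j | k
  · simpa [h] using hf j
  · simpa [h] using hg k

/-- Every retract of an object with noetherian endomorphism ring is a finite biproduct of
indecomposables. -/
theorem of_retract {X : C} [IsNoetherianRing (End X)] {Y : C} (h : Retract Y X) :
    IsFiniteBiproductOfIndecomposables Y := by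
  by_cases hY : IsZero Y
  · exact of_isZero hY
  by_cases hY' : Indecomposable Y
  · exact of_indecomposable hY'
  obtain ⟨A, B, e, hA, hB⟩ : ∃ (A B : C) (_ : Y ≅ A ⊞ B), ¬IsZero A ∧ ¬IsZero B := by
    simpa [Indecomposable, hY] using hY'
  let rA : Retract A Y := ⟨biprod.inl ≫ e.inv, e.hom ≫ biprod.fst, by simp⟩
  let rB : Retract B Y := ⟨biprod.inr ≫ e.inv, e.hom ≫ biprod.snd, by simp⟩
  have ne_zero {D : C} (r : Retract D Y) (hD : ¬IsZero D) : r.r ≫ r.i ≠ 0 := fun h0 =>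
    hD ((IsZero.iff_id_eq_zero D).2 (by simpa using r.i ≫= h0 =≫ r.r))
  have ltA : precompAnnihilator h.i < precompAnnihilator (rA.trans h).i :=
    precompAnnihilator_lt_comp h rA.i (rB.r ≫ rB.i) (by simp [rA, rB]) (ne_zero rB hB)
  have ltB : precompAnnihilator h.i < precompAnnihilator (rB.trans h).i :=
    precompAnnihilator_lt_comp h rB.i (rA.r ≫ rA.i) (by simp [rA, rB]) (ne_zero rA hA)
  exact of_iso_biprod e (of_retract (rA.trans h)) (of_retract (rB.trans h))
termination_by wellFounded_gt.wrap (precompAnnihilator h.i)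
decreasing_by
  · exact ltA
  · exact ltB

end IsFiniteBiproductOfIndecomposables

end Biproducts

/-- Let `C` be an additive category (preadditive with finite
biproducts) such that the endomorphism ring of every object is noetherian.  Then every
object of `C` is isomorphic to a finite biproduct of indecomposable objects.
(The instance `HasBinaryBiproducts C` is automatic from `HasFiniteBiproducts C`; it is
included so that the notion `Indecomposable` elaborates.) -/
theorem decomposition_into_indecomposables
    (C : Type*) [Category C] [Preadditive C] [HasFiniteBiproducts C]
    [HasBinaryBiproducts C]
    (hNoeth : ∀ X : C, IsNoetherianRing (End X)) :
    ∀ X : C, ∃ (n : ℕ) (f : Fin n → C),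
      (∀ i, Indecomposable (f i)) ∧ Nonempty (X ≅ ⨁ f) := by
  intro X
  have := hNoeth X
  exact IsFiniteBiproductOfIndecomposables.of_retract (Retract.refl X)
end

section
/- Let C be an additive category in which every object is isomorphic to a finite biproduct of objects whose endomorphism rings are nc local (i.e., the quotient by the Jacobson radical is a division ring). Then C is idempotent complete: every idempotent endomorphism e : X → X admits a splitting, i.e., there exist an object Y and morphisms π : X → Y, ι : Y → X with π ∘ ι = id_Y and ι ∘ π = e. -/
open CategoryTheory CategoryTheory.Limits

section Jacobson

variable {E : Type*} [Ring E]

lemma isUnit_of_sub_one_mem_jacobson_bot {r : E}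
    (hr : r - 1 ∈ (⊥ : TwoSidedIdeal E).jacobson) : IsUnit r := by
  have left_inv {s : E} (hs : s - 1 ∈ (⊥ : TwoSidedIdeal E).jacobson) : ∃ z, z * s = 1 := by
    obtain ⟨z, hz⟩ := TwoSidedIdeal.mem_jacobson_iff.1 hs 1
    rw [TwoSidedIdeal.mem_bot, mul_one, mul_sub, mul_one, sub_add_cancel, sub_eq_zero] at hz
    exact ⟨z, hz⟩
  obtain ⟨z, hz⟩ := left_inv hr
  obtain ⟨w, hw⟩ : ∃ w, w * z = 1 := left_inv <| by
    have h := TwoSidedIdeal.neg_mem _ (TwoSidedIdeal.mul_mem_left _ z _ hr)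
    rwa [mul_sub, hz, mul_one, neg_sub] at h
  exact isUnit_iff_exists_and_exists.2 ⟨⟨z, by rwa [← left_inv_eq_right_inv hw hz]⟩, z, hz⟩

lemma IsNcLocalRing.isUnit_or_isUnit_one_sub (h : IsNcLocalRing E) (x : E) :
    IsUnit x ∨ IsUnit (1 - x) := by
  let J := (⊥ : TwoSidedIdeal E).jacobson
  have mk_eq {y z : E} : (J.ringCon.mk' y = J.ringCon.mk' z) ↔ y - z ∈ J :=
    (RingCon.eq _).trans (J.rel_iff y z)
  by_cases hx : J.ringCon.mk' x = 0
  · right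
    rw [← map_zero J.ringCon.mk', mk_eq, sub_zero] at hx
    exact isUnit_of_sub_one_mem_jacobson_bot (by simpa using J.neg_mem hx)
  · left
    obtain ⟨y, hxy, hyx⟩ := isUnit_iff_exists.1 (h.2 _ hx)
    obtain ⟨y, rfl⟩ := J.ringCon.mk'_surjective y
    rw [← map_mul, ← map_one J.ringCon.mk', mk_eq] at hxy hyx
    obtain ⟨v, hv, -⟩ := isUnit_iff_exists.1 (isUnit_of_sub_one_mem_jacobson_bot hxy)
    obtain ⟨w, -, hw⟩ := isUnit_iff_exists.1 (isUnit_of_sub_one_mem_jacobson_bot hyx)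
    exact isUnit_iff_exists_and_exists.2
      ⟨⟨y * v, by rw [← mul_assoc, hv]⟩, w * y, by rw [mul_assoc, hw]⟩

end Jacobson

section Splitting

variable {C : Type*} [Category C]

/-- Every idempotent endomorphism of `X` splits. -/
def IdempotentsSplit (X : C) : Prop :=
  ∀ e : X ⟶ X, e ≫ e = e →
    ∃ (Y : C) (ι : Y ⟶ X) (π : X ⟶ Y), ι ≫ π = 𝟙 Y ∧ π ≫ ι = e

lemma IdempotentsSplit.of_iso {X X' : C} (φ : X ≅ X') (h : IdempotentsSplit X') :
    IdempotentsSplit X := fun e he ↦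
  (Idempotents.split_iff_of_iso φ e (φ.inv ≫ e ≫ φ.hom) (by simp)).2
    (h _ (by simp [reassoc_of% he]))

/-- An idempotent of `X` fixed on both sides by the idempotent `r ≫ i` of a retract `Z` splits
as soon as the idempotents of `Z` do. -/
lemma IdempotentsSplit.exists_splitting_of_retract {X Z : C} (hZ : IdempotentsSplit Z)
    {i : Z ⟶ X} {r : X ⟶ Z} (hir : i ≫ r = 𝟙 Z) {e : X ⟶ X} (he : e ≫ e = e)
    (hl : r ≫ i ≫ e = e) (hr : e ≫ r ≫ i = e) :
    ∃ (Y : C) (ι : Y ⟶ X) (π : X ⟶ Y), ι ≫ π = 𝟙 Y ∧ π ≫ ι = e := by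
  obtain ⟨Y, ι, π, h₁, h₂⟩ := hZ (i ≫ e ≫ r) (by
    simp only [Category.assoc, reassoc_of% hl, reassoc_of% he])
  refine ⟨Y, ι ≫ i, r ≫ π, by simp [reassoc_of% hir, h₁], ?_⟩
  rw [Category.assoc, reassoc_of% h₂, reassoc_of% hl, hr]

variable [Preadditive C]

/-- If `ι ≫ b = 𝟙` and `a ≫ b = 𝟙`, then a complement of `A` embedded through `ι` is also
a complement of `A` embedded through `a` with retraction `b`. -/
lemma exists_complement_of_comp_eq_id {A X Z : C} {ι : A ⟶ X} {π : X ⟶ A} {j : Z ⟶ X} {q : X ⟶ Z}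
    (hιq : ι ≫ q = 0) (hjq : j ≫ q = 𝟙 Z) (htot : π ≫ ι + q ≫ j = 𝟙 X)
    {a : A ⟶ X} {b : X ⟶ A} (hιb : ι ≫ b = 𝟙 A) (hab : a ≫ b = 𝟙 A) :
    ∃ (i : Z ⟶ X) (r : X ⟶ Z), i ≫ r = 𝟙 Z ∧ r ≫ i = 𝟙 X - b ≫ a := by
  have hqj : q ≫ j = 𝟙 X - π ≫ ι := eq_sub_of_add_eq' htot
  refine ⟨j - j ≫ b ≫ ι, q - b ≫ a ≫ q, ?_, ?_⟩
  · simp [hjq, hιq, reassoc_of% hιb]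
  · simp [reassoc_of% hqj, hqj, reassoc_of% hιb, reassoc_of% hab]
    abel

variable [HasBinaryBiproducts C]

lemma IdempotentsSplit.of_complement {A X Z : C} (hA : IsNcLocalRing (End A))
    (hZ : IdempotentsSplit Z) {ι : A ⟶ X} {π : X ⟶ A} {j : Z ⟶ X} {q : X ⟶ Z}
    (hιπ : ι ≫ π = 𝟙 A) (hιq : ι ≫ q = 0) (hjq : j ≫ q = 𝟙 Z)
    (htot : π ≫ ι + q ≫ j = 𝟙 X) : IdempotentsSplit X := by
  intro e he
  have key {f : X ⟶ X} (hf : f ≫ f = f) {v : A ⟶ A} (hv : ι ≫ f ≫ π ≫ v = 𝟙 A) :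
      ∃ (a : A ⟶ X) (b : X ⟶ A) (i : Z ⟶ X) (r : X ⟶ Z), a ≫ b = 𝟙 A ∧ a ≫ f = a ∧ f ≫ b = b ∧
        i ≫ r = 𝟙 Z ∧ r ≫ i = 𝟙 X - b ≫ a := by
    have hab : (ι ≫ f) ≫ f ≫ π ≫ v = 𝟙 A := by
      rw [Category.assoc, reassoc_of% hf, hv]
    obtain ⟨i, r, hir, hri⟩ := exists_complement_of_comp_eq_id hιq hjq htot hv hab
    exact ⟨ι ≫ f, f ≫ π ≫ v, i, r, hab, by rw [Category.assoc, hf], by rw [reassoc_of% hf],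
      hir, hri⟩
  rcases hA.isUnit_or_isUnit_one_sub (ι ≫ e ≫ π : A ⟶ A) with hu | hu <;>
    obtain ⟨v, -, hv⟩ := isUnit_iff_exists.1 hu
  · replace hv : (ι ≫ e ≫ π) ≫ v = 𝟙 A := hv
    obtain ⟨a, b, i, r, hab, hae, heb, hir, hri⟩ := key he (by simpa using hv)
    obtain ⟨Y, ι', π', h₁, h₂⟩ := hZ.exists_splitting_of_retract hir (e := e - b ≫ a)
      (by simp [he, hae, reassoc_of% heb, reassoc_of% hab])
      (by simp [reassoc_of% hri, hae, reassoc_of% hab])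
      (by simp [hri, reassoc_of% heb, reassoc_of% hab])
    have haπ : a ≫ π' = 0 := by
      have : a ≫ (π' ≫ ι') ≫ π' = 0 := by simp [h₂, reassoc_of% hae, reassoc_of% hab]
      simpa [h₁] using this
    have hιb : ι' ≫ b = 0 := by
      have : ι' ≫ (π' ≫ ι') ≫ b = 0 := by simp [h₂, heb, hab]
      simpa [reassoc_of% h₁] using this
    refine ⟨A ⊞ Y, biprod.desc a ι', biprod.lift b π', ?_, by simp [biprod.lift_desc, h₂]⟩
    ext <;> simp [hab, haπ, hιb, h₁]
  · replace hv : (𝟙 A - ι ≫ e ≫ π) ≫ v = 𝟙 A := hv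
    obtain ⟨a, b, i, r, -, hae, heb, hir, hri⟩ :=
      key (Idempotents.idem_of_id_sub_idem e he) (by simpa [reassoc_of% hιπ] using hv)
    have hae : a ≫ e = 0 := by simpa using hae
    have heb : e ≫ b = 0 := by simpa using heb
    exact hZ.exists_splitting_of_retract hir he
      (by simp [reassoc_of% hri, hae]) (by simp [hri, reassoc_of% heb])

end Splitting

lemma idempotentsSplit_biproduct {C : Type*} [Category C] [Preadditive C] [HasFiniteBiproducts C]
    {n : ℕ} (f : Fin n → C) (hf : ∀ i, IsNcLocalRing (End (f i))) : IdempotentsSplit (⨁ f) := by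
  have := hasBinaryBiproducts_of_finite_biproducts C
  induction n with
  | zero =>
    intro e _
    exact ⟨⨁ f, 𝟙 _, 𝟙 _, by simp, by ext i; exact i.elim0⟩
  | succ n ih =>
    refine .of_complement (hf 0) (ih (fun i ↦ f i.succ) fun i ↦ hf i.succ)
      (ι := biproduct.ι f 0) (π := biproduct.π f 0)
      (j := biproduct.desc fun i ↦ biproduct.ι f i.succ)
      (q := biproduct.lift fun i ↦ biproduct.π f i.succ) (by simp) ?_ ?_ ?_
    · ext i
      simp [biproduct.ι_π_ne f (Fin.succ_ne_zero i).symm]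
    · ext i k
      by_cases h : i = k
      · subst h
        simp
      · simp [biproduct.ι_π_ne _ (Ne.symm h),
          biproduct.ι_π_ne f fun h' ↦ h (Fin.succ_injective _ h').symm]
    · rw [biproduct.lift_desc, ← Fin.sum_univ_succ fun i ↦ biproduct.π f i ≫ biproduct.ι f i,
        biproduct.total]

/-- Let `C` be an additive category in which every object is
isomorphic to a finite biproduct of objects whose endomorphism rings are nc local.
Then `C` is idempotent complete: every idempotent endomorphism splits. -/
theorem idempotent_complete_of_krullSchmidt
    (C : Type*) [Category C] [Preadditive C] [HasFiniteBiproducts C]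
    (hKS : ∀ X : C, ∃ (n : ℕ) (f : Fin n → C),
      (∀ i, IsNcLocalRing (End (f i))) ∧ Nonempty (X ≅ ⨁ f)) :
    ∀ (X : C) (e : X ⟶ X), e ≫ e = e →
      ∃ (Y : C) (ι : Y ⟶ X) (π : X ⟶ Y), ι ≫ π = 𝟙 Y ∧ π ≫ ι = e := by
  intro X
  obtain ⟨n, f, hf, ⟨φ⟩⟩ := hKS X
  exact (idempotentsSplit_biproduct f hf).of_iso φ
end
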